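/- In a finite game that has at least one coarse correlated equilibrium, LP strong duality holds for the optimal-CCE linear program: sup{Σ_{s∈S} x_s w_s : x a coarse correlated equilibrium} = inf{max_{s∈S} w̃_s(y) : y a family of reals with all y^p_j ≥ 0}, and both the supremum and the infimum are attained. -/

import Mathlib

open Finset

noncomputable section

variable {N : Type} [Fintype N] [DecidableEq N]
variable {S : N → Type} [∀ p, Fintype (S p)] [∀ p, DecidableEq (S p)]

/-- Social welfare of a pure strategy profile: the sum of the players' utilities. -/
def socialWelfare (u : (p : N) → ((q : N) → S q) → ℝ) (s : (q : N) → S q) : ℝ :=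
  ∑ p, u p s

/-- A correlated distribution: a nonnegative function on pure profiles summing to one. -/
def IsCorrDist (x : ((q : N) → S q) → ℝ) : Prop :=
  (∀ s, 0 ≤ x s) ∧ ∑ s, x s = 1

/-- A correlated equilibrium. -/
def IsCE (u : (p : N) → ((q : N) → S q) → ℝ) (x : ((q : N) → S q) → ℝ) : Prop :=
  IsCorrDist x ∧ ∀ (p : N) (i j : S p),
    0 ≤ ∑ s ∈ Finset.univ.filter (fun s : (q : N) → S q => s p = i),
          (u p s - u p (Function.update s p j)) * x s

/-- A coarse correlated equilibrium. -/
def IsCCE (u : (p : N) → ((q : N) → S q) → ℝ) (x : ((q : N) → S q) → ℝ) : Prop :=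
  IsCorrDist x ∧ ∀ (p : N) (j : S p),
    0 ≤ ∑ s : (q : N) → S q, (u p s - u p (Function.update s p j)) * x s

/-- Deviation-adjusted utility of player `p` at profile `s`, given multipliers `y`. -/
def devAdjU (u : (p : N) → ((q : N) → S q) → ℝ) (y : (p : N) → S p → S p → ℝ)
    (p : N) (s : (q : N) → S q) : ℝ :=
  u p s + ∑ j : S p, y p (s p) j * (u p s - u p (Function.update s p j))

/-- Deviation-adjusted social welfare. -/
def devAdjSW (u : (p : N) → ((q : N) → S q) → ℝ) (y : (p : N) → S p → S p → ℝ)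
    (s : (q : N) → S q) : ℝ :=
  ∑ p, devAdjU u y p s

/-- Coarse deviation-adjusted utility of player `p` at profile `s`. -/
def cDevAdjU (u : (p : N) → ((q : N) → S q) → ℝ) (y : (p : N) → S p → ℝ)
    (p : N) (s : (q : N) → S q) : ℝ :=
  u p s + ∑ j : S p, y p j * (u p s - u p (Function.update s p j))

/-- Coarse deviation-adjusted social welfare. -/
def cDevAdjSW (u : (p : N) → ((q : N) → S q) → ℝ) (y : (p : N) → S p → ℝ)
    (s : (q : N) → S q) : ℝ :=
  ∑ p, cDevAdjU u y p s

/-- Weighted deviation-adjusted utility of player `p` at profile `s`. -/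
def wDevAdjU (u : (p : N) → ((q : N) → S q) → ℝ) (y : (p : N) → S p → S p → ℝ)
    (v : N → ℝ) (p : N) (s : (q : N) → S q) : ℝ :=
  v p * u p s + ∑ j : S p, y p (s p) j * (u p s - u p (Function.update s p j))

/-- Weighted deviation-adjusted social welfare. -/
def wDevAdjSW (u : (p : N) → ((q : N) → S q) → ℝ) (y : (p : N) → S p → S p → ℝ)
    (v : N → ℝ) (s : (q : N) → S q) : ℝ :=
  ∑ p, wDevAdjU u y v p s

/-- Number of players choosing action `α` under profile `s`. -/
def count {N A : Type} [Fintype N] [DecidableEq A] (s : N → A) (α : A) : ℕ :=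
  (Finset.univ.filter (fun p => s p = α)).card

/-- **Farkas' lemma** for finitely many linear functionals on a vector space. -/
theorem exists_nonneg_sum_smul_eq {ι W : Type*} [AddCommGroup W] [Module ℝ W]
    (t : Finset ι) (f : ι → W →ₗ[ℝ] ℝ) (g : W →ₗ[ℝ] ℝ)
    (h : ∀ x, (∀ i ∈ t, 0 ≤ f i x) → 0 ≤ g x) :
    ∃ c : ι → ℝ, (∀ i, 0 ≤ c i) ∧ ∀ x, g x = ∑ i ∈ t, c i * f i x := by
  classical
  induction t using Finset.induction_on generalizing f g with
  | empty =>
    refine ⟨0, fun _ => le_rfl, fun x => ?_⟩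
    have h₁ := h x (by simp)
    have h₂ := h (-x) (by simp)
    rw [map_neg] at h₂
    simp only [Finset.sum_empty]
    linarith
  | insert a t ha ih =>
    by_cases hg : ∀ x, (∀ i ∈ t, 0 ≤ f i x) → 0 ≤ g x
    · obtain ⟨c, hc, hsum⟩ := ih f g hg
      refine ⟨Function.update c a 0, fun i => ?_, fun x => ?_⟩
      · by_cases hi : i = a
        · simp [hi]
        · simp [hi, hc i]
      · rw [Finset.sum_insert ha, hsum x]
        simp only [Function.update_self, zero_mul, zero_add]
        refine Finset.sum_congr rfl fun i hi => ?_
        rw [Function.update_of_ne (ne_of_mem_of_not_mem hi ha)]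
    · push Not at hg
      obtain ⟨z, hz, hgz⟩ := hg
      have hfz : f a z < 0 := by
        by_contra! hneg
        exact hgz.not_ge (h z (by simpa [hneg] using hz))
      obtain ⟨b, hb, hfb⟩ : ∃ b : ℝ, 0 < b ∧ b * f a z = -1 :=
        ⟨-(f a z)⁻¹, by simpa using hfz, by rw [neg_mul, inv_mul_cancel₀ hfz.ne]⟩
      obtain ⟨c, hc, hsum⟩ := ih (fun i => f i + (b * f i z) • f a) (g + (b * g z) • f a) (by
        intro x hx
        have key := h (x + (b * f a x) • z) (by
          intro i hi
          rcases Finset.mem_insert.mp hi with rfl | hi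
          · simp only [map_add, map_smul, smul_eq_mul]
            have : b * f i x * f i z = -f i x := by linear_combination f i x * hfb
            linarith
          · have := hx i hi
            simp only [LinearMap.add_apply, LinearMap.smul_apply, smul_eq_mul] at this
            simp only [map_add, map_smul, smul_eq_mul]
            linarith)
        simp only [map_add, map_smul, smul_eq_mul] at key
        simp only [LinearMap.add_apply, LinearMap.smul_apply, smul_eq_mul]
        linarith)
      refine ⟨Function.update c a (∑ i ∈ t, c i * (b * f i z) - b * g z), fun i => ?_,
        fun x => ?_⟩
      · by_cases hi : i = a
        · subst hi
          have h₁ : 0 ≤ ∑ i ∈ t, c i * (b * f i z) := Finset.sum_nonneg fun i hi =>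
            mul_nonneg (hc i) (mul_nonneg hb.le (hz i hi))
          have h₂ : b * g z < 0 := mul_neg_of_pos_of_neg hb hgz
          simp only [Function.update_self]
          linarith
        · simp [hi, hc i]
      · have hx := hsum x
        simp only [LinearMap.add_apply, LinearMap.smul_apply, smul_eq_mul, mul_add,
          Finset.sum_add_distrib] at hx
        have hcongr : ∑ i ∈ t, Function.update c a
            (∑ i ∈ t, c i * (b * f i z) - b * g z) i * f i x = ∑ i ∈ t, c i * f i x :=
          Finset.sum_congr rfl fun i hi => by
            rw [Function.update_of_ne (ne_of_mem_of_not_mem hi ha)]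
        have hmul : ∑ i ∈ t, c i * (b * f i z * f a x) =
            (∑ i ∈ t, c i * (b * f i z)) * f a x := by
          rw [Finset.sum_mul]
          exact Finset.sum_congr rfl fun i _ => by ring
        rw [Finset.sum_insert ha, hcongr, Function.update_self]
        rw [hmul] at hx
        linarith

theorem cDevAdjSW_eq (u : (p : N) → ((q : N) → S q) → ℝ) (y : (p : N) → S p → ℝ)
    (s : (q : N) → S q) :
    cDevAdjSW u y s = socialWelfare u s +
      ∑ p, ∑ j : S p, y p j * (u p s - u p (Function.update s p j)) := by
  simp only [cDevAdjSW, cDevAdjU, socialWelfare, Finset.sum_add_distrib]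

/-- Weak duality: nonnegative multipliers bound the welfare of every coarse correlated
equilibrium. -/
theorem IsCCE.sum_mul_socialWelfare_le {u : (p : N) → ((q : N) → S q) → ℝ}
    {x : ((q : N) → S q) → ℝ} (hx : IsCCE u x) {y : (p : N) → S p → ℝ}
    (hy : ∀ (p : N) (j : S p), 0 ≤ y p j) {M : ℝ} (hM : ∀ s, cDevAdjSW u y s ≤ M) :
    ∑ s, x s * socialWelfare u s ≤ M := by
  have hdev : 0 ≤ ∑ s, x s * ∑ p, ∑ j : S p,
      y p j * (u p s - u p (Function.update s p j)) := by
    have hswap : ∑ s, x s * ∑ p, ∑ j : S p,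
        y p j * (u p s - u p (Function.update s p j)) =
        ∑ p, ∑ j : S p, y p j * ∑ s, (u p s - u p (Function.update s p j)) * x s := by
      simp only [Finset.mul_sum]
      rw [Finset.sum_comm]
      refine Finset.sum_congr rfl fun p _ => ?_
      rw [Finset.sum_comm]
      exact Finset.sum_congr rfl fun j _ => Finset.sum_congr rfl fun s _ => by ring
    rw [hswap]
    exact Finset.sum_nonneg fun p _ => Finset.sum_nonneg fun j _ =>
      mul_nonneg (hy p j) (hx.2 p j)
  calc ∑ s, x s * socialWelfare u s
      ≤ ∑ s, x s * cDevAdjSW u y s := by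
        simp only [cDevAdjSW_eq, mul_add, Finset.sum_add_distrib]
        linarith
    _ ≤ ∑ s, x s * M :=
        Finset.sum_le_sum fun s _ => mul_le_mul_of_nonneg_left (hM s) (hx.1.1 s)
    _ = M := by rw [← Finset.sum_mul, hx.1.2, one_mul]

theorem isCompact_setOf_isCCE (u : (p : N) → ((q : N) → S q) → ℝ) :
    IsCompact {x | IsCCE u x} := by
  have hset : {x | IsCCE u x} = stdSimplex ℝ ((q : N) → S q) ∩
      {x | ∀ (p : N) (j : S p),
        0 ≤ ∑ s : (q : N) → S q, (u p s - u p (Function.update s p j)) * x s} := rfl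
  rw [hset]
  refine (isCompact_stdSimplex ℝ _).inter_right ?_
  simp only [Set.ofPred_forall]
  exact isClosed_iInter fun p => isClosed_iInter fun j =>
    isClosed_le continuous_const (by fun_prop)

/-- Every upper bound on the welfare of the coarse correlated equilibria is certified by
nonnegative multipliers, provided that such an equilibrium exists. -/
theorem exists_cDevAdjSW_le (u : (p : N) → ((q : N) → S q) → ℝ) {V : ℝ}
    (hV : ∀ x, IsCCE u x → ∑ s, x s * socialWelfare u s ≤ V) :
    ∃ y : (p : N) → S p → ℝ, (∀ (p : N) (j : S p), 0 ≤ y p j) ∧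
      ∀ s, cDevAdjSW u y s ≤ V := by
  classical
  let L : (((q : N) → S q) → ℝ) → (((q : N) → S q) → ℝ) →ₗ[ℝ] ℝ :=
    fun a => Fintype.linearCombination ℝ a
  have hL : ∀ a x, L a x = ∑ s, x s * a s := fun a x => by
    simp [L, Fintype.linearCombination_apply]
  have hLs : ∀ a s, L a (Pi.single s 1) = a s := fun a s => by
    simp [hL, Pi.single_apply]
  let f : ((q : N) → S q) ⊕ (Σ p, S p) → (((q : N) → S q) → ℝ) →ₗ[ℝ] ℝ :=
    Sum.elim LinearMap.proj
      (fun i => L fun s => u i.1 s - u i.1 (Function.update s i.1 i.2))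
  obtain ⟨c, hc, hsum⟩ := exists_nonneg_sum_smul_eq Finset.univ f
    (L fun s => V - socialWelfare u s) (by
    intro x hx
    have hx₀ : ∀ s, 0 ≤ x s := fun s => hx (Sum.inl s) (Finset.mem_univ _)
    have hx₁ : ∀ (p : N) (j : S p),
        0 ≤ ∑ s : (q : N) → S q, (u p s - u p (Function.update s p j)) * x s := fun p j => by
      have := hx (Sum.inr ⟨p, j⟩) (Finset.mem_univ _)
      simp only [f, Sum.elim_inr, hL] at this
      simpa only [mul_comm] using this
    have hexp : L (fun s => V - socialWelfare u s) x =
        (∑ s, x s) * V - ∑ s, x s * socialWelfare u s := by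
      simp only [hL, mul_sub, Finset.sum_sub_distrib, Finset.sum_mul]
    rcases (Finset.sum_nonneg fun s _ => hx₀ s).eq_or_lt with h₀ | hpos
    · have hz : x = 0 := funext fun s =>
        (Finset.sum_eq_zero_iff_of_nonneg fun s _ => hx₀ s).mp h₀.symm s (Finset.mem_univ s)
      simp [hz]
    · set m := ∑ s, x s with hm
      have hle := hV (fun s => m⁻¹ * x s) ⟨⟨fun s => mul_nonneg (inv_nonneg.mpr hpos.le) (hx₀ s),
        by rw [← Finset.mul_sum, ← hm, inv_mul_cancel₀ hpos.ne']⟩, fun p j => by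
          have := mul_nonneg (inv_nonneg.mpr hpos.le) (hx₁ p j)
          rw [Finset.mul_sum] at this
          simpa only [mul_left_comm] using this⟩
      simp only [mul_assoc, ← Finset.mul_sum] at hle
      rw [inv_mul_le_iff₀ hpos] at hle
      rw [hexp]
      linarith)
  refine ⟨fun p j => c (Sum.inr ⟨p, j⟩), fun p j => hc _, fun s => ?_⟩
  have hs := hsum (Pi.single s 1)
  rw [Fintype.sum_sum_type, Fintype.sum_sigma] at hs
  simp only [f, Sum.elim_inl, Sum.elim_inr, hLs, LinearMap.proj_apply] at hs
  have hnn : 0 ≤ ∑ i, c (Sum.inl i) * (Pi.single s 1 : ((q : N) → S q) → ℝ) i :=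
    Finset.sum_nonneg fun i _ => mul_nonneg (hc _) (by
      rw [Pi.single_apply]; split_ifs <;> norm_num)
  rw [cDevAdjSW_eq]
  linarith

/-- strong LP duality for the optimal-CCE linear program: if the game has
a coarse correlated equilibrium, there is a CCE `x` attaining the maximum expected
social welfare, and a nonnegative `y` attaining the minimum of `max_s w̃_s(y)`, with
the two optimal values equal. -/
theorem optimal_cce_strong_duality [∀ p, Nonempty (S p)]
    (u : (p : N) → ((q : N) → S q) → ℝ)
    (hex : ∃ x : ((q : N) → S q) → ℝ, IsCCE u x) :
    ∃ (x : ((q : N) → S q) → ℝ) (y : (p : N) → S p → ℝ),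
      IsCCE u x ∧ (∀ (p : N) (j : S p), 0 ≤ y p j) ∧
      (∑ s, x s * socialWelfare u s =
        Finset.univ.sup' Finset.univ_nonempty
          (fun s : (q : N) → S q => cDevAdjSW u y s)) ∧
      (∀ x' : ((q : N) → S q) → ℝ, IsCCE u x' →
        ∑ s, x' s * socialWelfare u s ≤ ∑ s, x s * socialWelfare u s) ∧
      (∀ y' : (p : N) → S p → ℝ, (∀ (p : N) (j : S p), 0 ≤ y' p j) →
        Finset.univ.sup' Finset.univ_nonempty
            (fun s : (q : N) → S q => cDevAdjSW u y s) ≤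
          Finset.univ.sup' Finset.univ_nonempty
            (fun s : (q : N) → S q => cDevAdjSW u y' s)) := by
  obtain ⟨x, hx, hmax⟩ := (isCompact_setOf_isCCE u).exists_isMaxOn hex
    (f := fun x => ∑ s, x s * socialWelfare u s) (by fun_prop)
  have hopt : ∀ x' : ((q : N) → S q) → ℝ, IsCCE u x' →
      ∑ s, x' s * socialWelfare u s ≤ ∑ s, x s * socialWelfare u s := fun x' hx' => hmax hx'
  obtain ⟨y, hy, hle⟩ := exists_cDevAdjSW_le u hopt
  have hweak : ∀ y' : (p : N) → S p → ℝ, (∀ (p : N) (j : S p), 0 ≤ y' p j) →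
      ∑ s, x s * socialWelfare u s ≤ Finset.univ.sup' Finset.univ_nonempty
        (fun s : (q : N) → S q => cDevAdjSW u y' s) := fun y' hy' =>
    IsCCE.sum_mul_socialWelfare_le hx hy' fun s =>
      Finset.le_sup' (fun s : (q : N) → S q => cDevAdjSW u y' s) (Finset.mem_univ s)
  have hsup : Finset.univ.sup' Finset.univ_nonempty
      (fun s : (q : N) → S q => cDevAdjSW u y s) ≤ ∑ s, x s * socialWelfare u s :=
    Finset.sup'_le _ _ fun s _ => hle s
  exact ⟨x, y, hx, hy, le_antisymm (hweak y hy) hsup, hopt,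
    fun y' hy' => hsup.trans (hweak y' hy')⟩
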